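/- arXiv:1501.07371 — 2 statements merged into one kernel-verified Lean document; each statement's English description precedes it below -/
import Mathlib

section
/- Let ε, β > 0 and let u be an admissible solution of (★). Then for every t > 0: ‖u(t,·)‖²_{L²(ℝ)} + β‖∂_x u(t,·)‖²_{L²(ℝ)} + β²‖∂_x² u(t,·)‖²_{L²(ℝ)} + 2ε ∫₀ᵗ ‖∂_x u(s,·)‖²_{L²(ℝ)} ds = ‖u(0,·)‖²_{L²(ℝ)} + β‖∂_x u(0,·)‖²_{L²(ℝ)} + β²‖∂_x² u(0,·)‖²_{L²(ℝ)}. In particular, if the right-hand side is bounded by C₀ then the left-hand side is bounded by C₀ for all t > 0. -/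
open MeasureTheory Real Filter Set

noncomputable section

/-- `mixedD u j k t x`: `j` time derivatives of the `k`-th spatial derivative of `u` at `(t,x)`. -/
def mixedD (u : ℝ → ℝ → ℝ) (j k : ℕ) (t x : ℝ) : ℝ :=
  iteratedDeriv j (fun s => iteratedDeriv k (fun y => u s y) x) t

/-- Squared `L²` norm in the space variable. -/
def sqL2 (f : ℝ → ℝ) : ℝ := ∫ x : ℝ, (f x) ^ 2

/-- `L²` norm in the space variable. -/
def nL2 (f : ℝ → ℝ) : ℝ := Real.sqrt (∫ x : ℝ, (f x) ^ 2)

/-- `L⁴` norm in the space variable. -/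
def nL4 (f : ℝ → ℝ) : ℝ := (∫ x : ℝ, (f x) ^ 4) ^ ((1 : ℝ) / 4)

/-- Admissible solution of the Rosenau–KdV–RLW approximation (★). -/
structure IsAdmissibleKdVRLW (ε β : ℝ) (u : ℝ → ℝ → ℝ) : Prop where
  smooth : ContDiff ℝ (⊤ : ℕ∞) (fun p : ℝ × ℝ => u p.1 p.2)
  pde : ∀ t > (0 : ℝ), ∀ x : ℝ,
    mixedD u 1 0 t x + deriv (fun y => (u t y) ^ 2) x
      + β * mixedD u 0 3 t x - β * mixedD u 1 2 t x
      + β ^ 2 * mixedD u 1 4 t x = ε * mixedD u 0 2 t x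
  sq_int : ∀ T > (0 : ℝ), ∀ j k : ℕ, j + k ≤ 5 → ∀ t ∈ Set.Icc (0 : ℝ) T,
    MeasureTheory.Integrable (fun x : ℝ => (mixedD u j k t x) ^ 2)
  decay : ∀ T > (0 : ℝ), ∀ j k : ℕ, j + k ≤ 5 → ∀ δ > (0 : ℝ), ∃ M : ℝ,
    ∀ x : ℝ, M ≤ |x| → ∀ t ∈ Set.Icc (0 : ℝ) T, |mixedD u j k t x| ≤ δ

/-- Admissible solution of the Rosenau–RLW approximation (★★). -/
structure IsAdmissibleRLW (ε β : ℝ) (u : ℝ → ℝ → ℝ) : Prop where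
  smooth : ContDiff ℝ (⊤ : ℕ∞) (fun p : ℝ × ℝ => u p.1 p.2)
  pde : ∀ t > (0 : ℝ), ∀ x : ℝ,
    mixedD u 1 0 t x + deriv (fun y => (u t y) ^ 2) x
      - β * mixedD u 1 2 t x + β ^ 2 * mixedD u 1 4 t x = ε * mixedD u 0 2 t x
  sq_int : ∀ T > (0 : ℝ), ∀ j k : ℕ, j + k ≤ 5 → ∀ t ∈ Set.Icc (0 : ℝ) T,
    MeasureTheory.Integrable (fun x : ℝ => (mixedD u j k t x) ^ 2)
  decay : ∀ T > (0 : ℝ), ∀ j k : ℕ, j + k ≤ 5 → ∀ δ > (0 : ℝ), ∃ M : ℝ,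
    ∀ x : ℝ, M ≤ |x| → ∀ t ∈ Set.Icc (0 : ℝ) T, |mixedD u j k t x| ≤ δ

/-- Data bounds with constant `C0` for the (★) approximation. -/
def DataBoundsKdVRLW (ε β C0 : ℝ) (f : ℝ → ℝ) : Prop :=
  (∫ x : ℝ, (f x) ^ 2) + (∫ x : ℝ, (f x) ^ 4)
      + (β + ε ^ 2) * (∫ x : ℝ, (deriv f x) ^ 2) ≤ C0 ∧
  (β * ε + β * ε ^ 2 + β ^ 2) * (∫ x : ℝ, (iteratedDeriv 2 f x) ^ 2)
      + (β ^ 2 * ε ^ 2 + β ^ 3) * (∫ x : ℝ, (iteratedDeriv 3 f x) ^ 2) ≤ C0 ∧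
  β ^ 4 * (∫ x : ℝ, (iteratedDeriv 4 f x) ^ 2) ≤ C0

/-- Data bounds with constant `C0` for the (★★) approximation. -/
def DataBoundsRLW (ε β C0 : ℝ) (f : ℝ → ℝ) : Prop :=
  (∫ x : ℝ, (f x) ^ 2) + (∫ x : ℝ, (f x) ^ 4)
    + β * ε ^ 2 * (∫ x : ℝ, (iteratedDeriv 2 f x) ^ 2) ≤ C0

/-- `u ∈ L^∞((0,∞); L²(ℝ) ∩ L⁴(ℝ))`. -/
def BddL2L4 (u : ℝ → ℝ → ℝ) : Prop :=
  ∃ M : ℝ, ∀ t > (0 : ℝ), (∫ x : ℝ, (u t x) ^ 2) ≤ M ∧ (∫ x : ℝ, (u t x) ^ 4) ≤ M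

/-- Entropy solution of `∂ₜ u + ∂ₓ (u²) = 0` with initial datum `u0`. -/
def IsEntropySolution (u : ℝ → ℝ → ℝ) (u0 : ℝ → ℝ) : Prop :=
  ∀ η : ℝ → ℝ, ContDiff ℝ 2 η → ConvexOn ℝ Set.univ η →
    (∃ M : ℝ, ∀ v : ℝ, |deriv η v| ≤ M) →
    ∀ φ : ℝ → ℝ → ℝ, ContDiff ℝ (⊤ : ℕ∞) (fun p : ℝ × ℝ => φ p.1 p.2) →
      HasCompactSupport (fun p : ℝ × ℝ => φ p.1 p.2) →
      (∀ t x : ℝ, 0 ≤ φ t x) →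
      0 ≤ (∫ t in Set.Ioi (0 : ℝ), ∫ x : ℝ,
            (η (u t x) * deriv (fun s => φ s x) t
              + (∫ ξ in (0 : ℝ)..(u t x), 2 * ξ * deriv η ξ) * deriv (fun y => φ t y) x))
          + ∫ x : ℝ, η (u0 x) * φ 0 x

/-- Partial derivative of a function on the plane in the first (time) variable. -/
def partialT (G : ℝ × ℝ → ℝ) (p : ℝ × ℝ) : ℝ := fderiv ℝ G p (1, 0)

/-- Partial derivative of a function on the plane in the second (space) variable. -/
def partialX (G : ℝ × ℝ → ℝ) (p : ℝ × ℝ) : ℝ := fderiv ℝ G p (0, 1)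

section PartialDerivatives

variable {G : ℝ × ℝ → ℝ}

lemma contDiff_partialT (hG : ContDiff ℝ (⊤ : ℕ∞) G) : ContDiff ℝ (⊤ : ℕ∞) (partialT G) :=
  (hG.fderiv_right (m := (⊤ : ℕ∞)) (by simp)).clm_apply contDiff_const

lemma contDiff_partialX (hG : ContDiff ℝ (⊤ : ℕ∞) G) : ContDiff ℝ (⊤ : ℕ∞) (partialX G) :=
  (hG.fderiv_right (m := (⊤ : ℕ∞)) (by simp)).clm_apply contDiff_const

lemma contDiff_partialX_iterate (hG : ContDiff ℝ (⊤ : ℕ∞) G) (k : ℕ) :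
    ContDiff ℝ (⊤ : ℕ∞) (partialX^[k] G) := by
  induction k with
  | zero => exact hG
  | succ k ih => rw [Function.iterate_succ_apply']; exact contDiff_partialX ih

lemma hasDerivAt_partialT (hG : ContDiff ℝ (⊤ : ℕ∞) G) (t x : ℝ) :
    HasDerivAt (fun s => G (s, x)) (partialT G (t, x)) t :=
  ((hG.differentiable (by simp)).differentiableAt.hasFDerivAt).comp_hasDerivAt t
    ((hasDerivAt_id t).prodMk (hasDerivAt_const t x))

lemma hasDerivAt_partialX (hG : ContDiff ℝ (⊤ : ℕ∞) G) (t x : ℝ) :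
    HasDerivAt (fun y => G (t, y)) (partialX G (t, x)) x :=
  ((hG.differentiable (by simp)).differentiableAt.hasFDerivAt).comp_hasDerivAt x
    ((hasDerivAt_const x t).prodMk (hasDerivAt_id x))

lemma partialX_partialT (hG : ContDiff ℝ (⊤ : ℕ∞) G) :
    partialX (partialT G) = partialT (partialX G) := by
  funext p
  have hd : DifferentiableAt ℝ (fderiv ℝ G) p :=
    ((hG.fderiv_right (m := (⊤ : ℕ∞)) (by simp)).differentiable (by simp)).differentiableAt
  have hsymm : IsSymmSndFDerivAt ℝ G p :=
    hG.contDiffAt.isSymmSndFDerivAt (by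
      rw [minSmoothness_of_isRCLikeNormedField]
      exact WithTop.coe_le_coe.2 (le_top : (2 : ℕ∞) ≤ ⊤))
  have key (v w : ℝ × ℝ) :
      fderiv ℝ (fun q => fderiv ℝ G q v) p w = fderiv ℝ (fderiv ℝ G) p w v := by
    rw [fderiv_clm_apply hd (differentiableAt_const v)]
    simp
  exact (key _ _).trans ((hsymm _ _).trans (key _ _).symm)

end PartialDerivatives

section MixedDerivatives

variable {u : ℝ → ℝ → ℝ}

lemma iteratedDeriv_eq_partialX_iterate
    (hu : ContDiff ℝ (⊤ : ℕ∞) (fun p : ℝ × ℝ => u p.1 p.2)) (k : ℕ) (t x : ℝ) :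
    iteratedDeriv k (fun y => u t y) x = partialX^[k] (fun p : ℝ × ℝ => u p.1 p.2) (t, x) := by
  induction k generalizing x with
  | zero => simp
  | succ k ih =>
    rw [iteratedDeriv_succ, Function.iterate_succ_apply', funext ih]
    exact (hasDerivAt_partialX (contDiff_partialX_iterate hu k) t x).deriv

lemma mixedD_zero_eq (hu : ContDiff ℝ (⊤ : ℕ∞) (fun p : ℝ × ℝ => u p.1 p.2)) (k : ℕ) (t x : ℝ) :
    mixedD u 0 k t x = partialX^[k] (fun p : ℝ × ℝ => u p.1 p.2) (t, x) := by
  simp [mixedD, iteratedDeriv_eq_partialX_iterate hu]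

lemma mixedD_one_eq (hu : ContDiff ℝ (⊤ : ℕ∞) (fun p : ℝ × ℝ => u p.1 p.2)) (k : ℕ) (t x : ℝ) :
    mixedD u 1 k t x = partialT (partialX^[k] (fun p : ℝ × ℝ => u p.1 p.2)) (t, x) := by
  simp only [mixedD, iteratedDeriv_eq_partialX_iterate hu, iteratedDeriv_one]
  exact (hasDerivAt_partialT (contDiff_partialX_iterate hu k) t x).deriv

lemma continuous_mixedD_zero (hu : ContDiff ℝ (⊤ : ℕ∞) (fun p : ℝ × ℝ => u p.1 p.2)) (k : ℕ) :
    Continuous (Function.uncurry (mixedD u 0 k)) := by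
  have h : Function.uncurry (mixedD u 0 k) = partialX^[k] (fun p : ℝ × ℝ => u p.1 p.2) :=
    funext fun p => mixedD_zero_eq hu k p.1 p.2
  rw [h]
  exact (contDiff_partialX_iterate hu k).continuous

lemma continuous_mixedD_one (hu : ContDiff ℝ (⊤ : ℕ∞) (fun p : ℝ × ℝ => u p.1 p.2)) (k : ℕ) :
    Continuous (Function.uncurry (mixedD u 1 k)) := by
  have h : Function.uncurry (mixedD u 1 k) =
      partialT (partialX^[k] (fun p : ℝ × ℝ => u p.1 p.2)) :=
    funext fun p => mixedD_one_eq hu k p.1 p.2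
  rw [h]
  exact (contDiff_partialT (contDiff_partialX_iterate hu k)).continuous

lemma hasDerivAt_mixedD_zero_space (hu : ContDiff ℝ (⊤ : ℕ∞) (fun p : ℝ × ℝ => u p.1 p.2))
    (k : ℕ) (t x : ℝ) :
    HasDerivAt (fun y => mixedD u 0 k t y) (mixedD u 0 (k + 1) t x) x := by
  simp only [mixedD_zero_eq hu, Function.iterate_succ_apply']
  exact hasDerivAt_partialX (contDiff_partialX_iterate hu k) t x

lemma hasDerivAt_mixedD_zero_time (hu : ContDiff ℝ (⊤ : ℕ∞) (fun p : ℝ × ℝ => u p.1 p.2))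
    (k : ℕ) (t x : ℝ) :
    HasDerivAt (fun s => mixedD u 0 k s x) (mixedD u 1 k t x) t := by
  simp only [mixedD_zero_eq hu, mixedD_one_eq hu]
  exact hasDerivAt_partialT (contDiff_partialX_iterate hu k) t x

lemma hasDerivAt_mixedD_one_space (hu : ContDiff ℝ (⊤ : ℕ∞) (fun p : ℝ × ℝ => u p.1 p.2))
    (k : ℕ) (t x : ℝ) :
    HasDerivAt (fun y => mixedD u 1 k t y) (mixedD u 1 (k + 1) t x) x := by
  simp only [mixedD_one_eq hu, Function.iterate_succ_apply']
  rw [← partialX_partialT (contDiff_partialX_iterate hu k)]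
  exact hasDerivAt_partialX (contDiff_partialT (contDiff_partialX_iterate hu k)) t x

end MixedDerivatives

/-- Integrating a balance law `∂ₜ e + d = ∂ₓ F` over the rectangle `[0, t] × [a, b]`. -/
lemma integral_balance_law {e e' F F' d : ℝ → ℝ → ℝ}
    (he' : Continuous (Function.uncurry e')) (hF' : Continuous (Function.uncurry F'))
    (he : Continuous (Function.uncurry e)) (hd : Continuous (Function.uncurry d))
    (hde : ∀ s x, HasDerivAt (fun r => e r x) (e' s x) s)
    (hdF : ∀ s x, HasDerivAt (fun y => F s y) (F' s x) x)
    (hbal : ∀ s > 0, ∀ x, e' s x = F' s x - d s x) {t : ℝ} (ht : 0 < t) (a b : ℝ) :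
    (∫ s in (0 : ℝ)..t, ∫ x in a..b, d s x) =
      (∫ s in (0 : ℝ)..t, (F s b - F s a)) - ((∫ x in a..b, e t x) - ∫ x in a..b, e 0 x) := by
  have hslice {f : ℝ → ℝ → ℝ} (hf : Continuous (Function.uncurry f)) (s : ℝ) :
      Continuous (f s) := hf.comp (by fun_prop : Continuous fun x => (s, x))
  have hslice' {f : ℝ → ℝ → ℝ} (hf : Continuous (Function.uncurry f)) (x : ℝ) :
      Continuous (fun s => f s x) := hf.comp (by fun_prop : Continuous fun s => (s, x))
  have hpar {f : ℝ → ℝ → ℝ} (hf : Continuous (Function.uncurry f)) :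
      Continuous fun s => ∫ x in a..b, f s x :=
    intervalIntegral.continuous_parametric_intervalIntegral_of_continuous' hf a b
  have hfluxint (s : ℝ) : ∫ x in a..b, F' s x = F s b - F s a :=
    intervalIntegral.integral_eq_sub_of_hasDerivAt (fun x _ => hdF s x)
      ((hslice hF' s).intervalIntegrable _ _)
  have hswap : ∫ x in a..b, ∫ s in (0 : ℝ)..t, e' s x = ∫ s in (0 : ℝ)..t, ∫ x in a..b, e' s x := by
    refine (intervalIntegral_intervalIntegral_swap ?_).symm
    refine IntegrableOn.mono_set ?_
      (prod_mono uIoc_subset_uIcc uIoc_subset_uIcc : _ ⊆ uIcc (0 : ℝ) t ×ˢ uIcc a b)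
    exact he'.continuousOn.integrableOn_compact (isCompact_uIcc.prod isCompact_uIcc)
  have htime : ∫ x in a..b, ∫ s in (0 : ℝ)..t, e' s x =
      (∫ x in a..b, e t x) - ∫ x in a..b, e 0 x := by
    rw [← intervalIntegral.integral_sub ((hslice he t).intervalIntegrable _ _)
      ((hslice he 0).intervalIntegrable _ _)]
    refine intervalIntegral.integral_congr fun x _ => ?_
    exact intervalIntegral.integral_eq_sub_of_hasDerivAt (fun s _ => hde s x)
      ((hslice' he' x).intervalIntegrable _ _)
  have hspace : ∫ s in (0 : ℝ)..t, ∫ x in a..b, e' s x =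
      ∫ s in (0 : ℝ)..t, ((F s b - F s a) - ∫ x in a..b, d s x) := by
    refine intervalIntegral.integral_congr_ae (ae_of_all _ fun s hs => ?_)
    rw [uIoc_of_le ht.le] at hs
    rw [← hfluxint s, ← intervalIntegral.integral_sub ((hslice hF' s).intervalIntegrable _ _)
      ((hslice hd s).intervalIntegrable _ _)]
    exact intervalIntegral.integral_congr fun x _ => hbal s hs.1 x
  rw [intervalIntegral.integral_sub _ ((hpar hd).intervalIntegrable _ _)] at hspace
  · linarith
  · simp only [← hfluxint]
    exact (hpar hF').intervalIntegrable _ _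

/-- A nonnegative continuous function on a strip, whose integrals over the exhausting rectangles
`[0, t] × [-n, n]` converge, has the limit as its iterated integral. -/
lemma intervalIntegral_integral_eq_of_tendsto {d : ℝ → ℝ → ℝ}
    (hd : Continuous (Function.uncurry d)) (hnonneg : ∀ s x, 0 ≤ d s x) {t I : ℝ} (ht : 0 ≤ t)
    (hI : Tendsto (fun n : ℕ => ∫ s in (0 : ℝ)..t, ∫ x in (-(n : ℝ))..n, d s x) atTop (nhds I)) :
    ∫ s in (0 : ℝ)..t, ∫ x, d s x = I := by
  set μ : Measure (ℝ × ℝ) := (volume.restrict (Ioc 0 t)).prod volume with hμ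
  have hcover : AECover μ atTop (fun n : ℕ => univ ×ˢ Ioc (-(n : ℝ)) n) := by
    refine ⟨ae_of_all _ fun p => ?_, fun n => MeasurableSet.univ.prod measurableSet_Ioc⟩
    obtain ⟨N, hN⟩ := exists_nat_gt |p.2|
    filter_upwards [eventually_ge_atTop N] with n hn
    have hlt : |p.2| < n := hN.trans_le (by exact_mod_cast hn)
    exact ⟨trivial, (abs_lt.1 hlt).1, (abs_lt.1 hlt).2.le⟩
  have hint (n : ℕ) : IntegrableOn (Function.uncurry d) (univ ×ˢ Ioc (-(n : ℝ)) n) μ := by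
    rw [IntegrableOn, hμ, ← Measure.prod_restrict, Measure.restrict_univ, Measure.prod_restrict]
    exact (hd.continuousOn.integrableOn_compact (isCompact_Icc.prod isCompact_Icc)).mono_set
      (prod_mono Ioc_subset_Icc_self Ioc_subset_Icc_self)
  have hval (n : ℕ) : ∫ p in univ ×ˢ Ioc (-(n : ℝ)) n, Function.uncurry d p ∂μ =
      ∫ s in (0 : ℝ)..t, ∫ x in (-(n : ℝ))..n, d s x := by
    rw [setIntegral_prod _ (hint n), Measure.restrict_univ, intervalIntegral.integral_of_le ht]
    simp only [intervalIntegral.integral_of_le (neg_le_self (Nat.cast_nonneg (α := ℝ) n)),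
      Function.uncurry]
  have hlim : Tendsto (fun n : ℕ => ∫ p in univ ×ˢ Ioc (-(n : ℝ)) n, Function.uncurry d p ∂μ)
      atTop (nhds I) := by
    simpa only [hval] using hI
  have hfull : Integrable (Function.uncurry d) μ :=
    hcover.integrable_of_integral_tendsto_of_nonneg_ae I hint
      (ae_of_all _ fun p => hnonneg p.1 p.2) hlim
  have := tendsto_nhds_unique hlim (hcover.integral_tendsto_of_countably_generated hfull)
  rw [this, integral_prod _ hfull, intervalIntegral.integral_of_le ht]
  rfl

/-- The energy density of (★). -/
def energyDensity (β : ℝ) (u : ℝ → ℝ → ℝ) (t x : ℝ) : ℝ :=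
  mixedD u 0 0 t x ^ 2 + β * mixedD u 0 1 t x ^ 2 + β ^ 2 * mixedD u 0 2 t x ^ 2

/-- The energy flux of (★). -/
def energyFlux (ε β : ℝ) (u : ℝ → ℝ → ℝ) (t x : ℝ) : ℝ :=
  -(4 / 3) * mixedD u 0 0 t x ^ 3
    - β * (2 * (mixedD u 0 0 t x * mixedD u 0 2 t x) - mixedD u 0 1 t x ^ 2)
    + 2 * β * (mixedD u 0 0 t x * mixedD u 1 1 t x)
    - 2 * β ^ 2 * (mixedD u 0 0 t x * mixedD u 1 3 t x - mixedD u 0 1 t x * mixedD u 1 2 t x)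
    + 2 * ε * (mixedD u 0 0 t x * mixedD u 0 1 t x)

namespace IsAdmissibleKdVRLW

variable {ε β : ℝ} {u : ℝ → ℝ → ℝ}

lemma tendsto_mixedD (hu : IsAdmissibleKdVRLW ε β u) {j k : ℕ} (hjk : j + k ≤ 5) {t : ℝ}
    (ht : 0 ≤ t) {y : ℕ → ℝ} (hy : ∀ n, |y n| = n) :
    Tendsto (fun n => mixedD u j k t (y n)) atTop (nhds 0) := by
  rw [Metric.tendsto_atTop]
  intro δ hδ
  obtain ⟨M, hM⟩ := hu.decay (t + 1) (by linarith) j k hjk (δ / 2) (by linarith)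
  obtain ⟨N, hN⟩ := exists_nat_ge M
  refine ⟨N, fun n hn => ?_⟩
  have hMn : M ≤ |y n| := by
    rw [hy]
    exact hN.trans (by exact_mod_cast hn)
  have := hM (y n) hMn t ⟨ht, by linarith⟩
  rw [Real.dist_eq, sub_zero]
  linarith

lemma eventually_abs_mixedD_le_one (hu : IsAdmissibleKdVRLW ε β u) {j k : ℕ} (hjk : j + k ≤ 5)
    {t : ℝ} (ht : 0 < t) {y : ℕ → ℝ} (hy : ∀ n, |y n| = n) :
    ∀ᶠ n in atTop, ∀ s ∈ Icc 0 t, |mixedD u j k s (y n)| ≤ 1 := by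
  obtain ⟨M, hM⟩ := hu.decay t ht j k hjk 1 one_pos
  obtain ⟨N, hN⟩ := exists_nat_ge M
  filter_upwards [eventually_ge_atTop N] with n hn
  refine hM (y n) ?_
  rw [hy]
  exact hN.trans (by exact_mod_cast hn)

lemma continuous_energyFlux (hu : IsAdmissibleKdVRLW ε β u) :
    Continuous (Function.uncurry (energyFlux ε β u)) := by
  have h0 := continuous_mixedD_zero hu.smooth
  have h1 := continuous_mixedD_one hu.smooth
  have h00 := h0 0
  have h01 := h0 1
  have h02 := h0 2
  have h11 := h1 1
  have h12 := h1 2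
  have h13 := h1 3
  simp only [Function.uncurry_def] at *
  unfold energyFlux
  fun_prop

lemma tendsto_energyFlux (hu : IsAdmissibleKdVRLW ε β u) {t : ℝ} (ht : 0 ≤ t) {y : ℕ → ℝ}
    (hy : ∀ n, |y n| = n) :
    Tendsto (fun n => energyFlux ε β u t (y n)) atTop (nhds 0) := by
  have h00 := hu.tendsto_mixedD (j := 0) (k := 0) (by norm_num) ht hy
  have h01 := hu.tendsto_mixedD (j := 0) (k := 1) (by norm_num) ht hy
  have h02 := hu.tendsto_mixedD (j := 0) (k := 2) (by norm_num) ht hy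
  have h11 := hu.tendsto_mixedD (j := 1) (k := 1) (by norm_num) ht hy
  have h12 := hu.tendsto_mixedD (j := 1) (k := 2) (by norm_num) ht hy
  have h13 := hu.tendsto_mixedD (j := 1) (k := 3) (by norm_num) ht hy
  have := (((((h00.pow 3).const_mul (-(4 / 3))).sub
    ((((h00.mul h02).const_mul 2).sub (h01.pow 2)).const_mul β)).add
    ((h00.mul h11).const_mul (2 * β))).sub
    (((h00.mul h13).sub (h01.mul h12)).const_mul (2 * β ^ 2))).add
    ((h00.mul h01).const_mul (2 * ε))
  simpa [energyFlux] using this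

lemma eventually_abs_energyFlux_le (hu : IsAdmissibleKdVRLW ε β u) (hε : 0 < ε) (hβ : 0 < β)
    {t : ℝ} (ht : 0 < t) {y : ℕ → ℝ} (hy : ∀ n, |y n| = n) :
    ∀ᶠ n in atTop, ∀ s ∈ Icc 0 t,
      |energyFlux ε β u s (y n)| ≤ 4 / 3 + 5 * β + 4 * β ^ 2 + 2 * ε := by
  have mul_le {p q : ℝ} (hp : |p| ≤ 1) (hq : |q| ≤ 1) : |p * q| ≤ 1 := by
    rw [abs_mul]
    exact mul_le_one₀ hp (abs_nonneg _) hq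
  filter_upwards [hu.eventually_abs_mixedD_le_one (j := 0) (k := 0) (by norm_num) ht hy,
    hu.eventually_abs_mixedD_le_one (j := 0) (k := 1) (by norm_num) ht hy,
    hu.eventually_abs_mixedD_le_one (j := 0) (k := 2) (by norm_num) ht hy,
    hu.eventually_abs_mixedD_le_one (j := 1) (k := 1) (by norm_num) ht hy,
    hu.eventually_abs_mixedD_le_one (j := 1) (k := 2) (by norm_num) ht hy,
    hu.eventually_abs_mixedD_le_one (j := 1) (k := 3) (by norm_num) ht hy]
    with n h00 h01 h02 h11 h12 h13 s hs
  have scale {c p : ℝ} (hc : 0 ≤ c) (hp : |p| ≤ 1) : |c * p| ≤ c := by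
    rw [abs_mul, abs_of_nonneg hc]
    exact mul_le_of_le_one_right hc hp
  have hβ2 := sq_nonneg β
  have k1 := mul_le (h00 s hs) (mul_le (h00 s hs) (h00 s hs))
  have k2 := abs_le.1 (scale hβ.le (mul_le (h00 s hs) (h02 s hs)))
  have k3 := abs_le.1 (scale hβ.le (mul_le (h01 s hs) (h01 s hs)))
  have k4 := abs_le.1 (scale hβ.le (mul_le (h00 s hs) (h11 s hs)))
  have k5 := abs_le.1 (scale hβ2 (mul_le (h00 s hs) (h13 s hs)))
  have k6 := abs_le.1 (scale hβ2 (mul_le (h01 s hs) (h12 s hs)))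
  have k7 := abs_le.1 (scale hε.le (mul_le (h00 s hs) (h01 s hs)))
  rw [abs_le] at k1 ⊢
  unfold energyFlux
  constructor <;> linarith

lemma tendsto_integral_energyFlux (hu : IsAdmissibleKdVRLW ε β u) (hε : 0 < ε) (hβ : 0 < β)
    {t : ℝ} (ht : 0 < t) {y : ℕ → ℝ} (hy : ∀ n, |y n| = n) :
    Tendsto (fun n => ∫ s in (0 : ℝ)..t, energyFlux ε β u s (y n)) atTop (nhds 0) := by
  have hsub {s : ℝ} (hs : s ∈ uIoc 0 t) : s ∈ Icc 0 t := by
    rw [uIoc_of_le ht.le] at hs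
    exact Ioc_subset_Icc_self hs
  have := intervalIntegral.tendsto_integral_filter_of_dominated_convergence (μ := volume)
    (a := 0) (b := t) (l := atTop) (F := fun n s => energyFlux ε β u s (y n)) (f := fun _ => 0)
    (fun _ => 4 / 3 + 5 * β + 4 * β ^ 2 + 2 * ε)
    (Eventually.of_forall fun n => (hu.continuous_energyFlux.comp
      (by fun_prop : Continuous fun s => (s, y n))).aestronglyMeasurable)
    ((hu.eventually_abs_energyFlux_le hε hβ ht hy).mono fun n hn =>
      ae_of_all _ fun s hs => hn s (hsub hs))
    intervalIntegrable_const
    (ae_of_all _ fun s hs => hu.tendsto_energyFlux (hsub hs).1 hy)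
  simpa using this

lemma integrable_sq_mixedD (hu : IsAdmissibleKdVRLW ε β u) {j k : ℕ} (hjk : j + k ≤ 5) {t : ℝ}
    (ht : 0 ≤ t) : Integrable (fun x => mixedD u j k t x ^ 2) :=
  hu.sq_int (t + 1) (by linarith) j k hjk t ⟨ht, by linarith⟩

lemma integrable_energyDensity (hu : IsAdmissibleKdVRLW ε β u) {t : ℝ} (ht : 0 ≤ t) :
    Integrable (energyDensity β u t) :=
  ((hu.integrable_sq_mixedD (by norm_num) ht).add
    ((hu.integrable_sq_mixedD (by norm_num) ht).const_mul β)).add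
    ((hu.integrable_sq_mixedD (by norm_num) ht).const_mul (β ^ 2))

lemma integral_energyDensity (hu : IsAdmissibleKdVRLW ε β u) {t : ℝ} (ht : 0 ≤ t) :
    ∫ x, energyDensity β u t x =
      sqL2 (u t) + β * sqL2 (fun x => mixedD u 0 1 t x)
        + β ^ 2 * sqL2 (fun x => mixedD u 0 2 t x) := by
  have h0 := hu.integrable_sq_mixedD (j := 0) (k := 0) (by norm_num) ht
  have h1 := (hu.integrable_sq_mixedD (j := 0) (k := 1) (by norm_num) ht).const_mul β
  have h2 := (hu.integrable_sq_mixedD (j := 0) (k := 2) (by norm_num) ht).const_mul (β ^ 2)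
  have hzero : u t = fun x => mixedD u 0 0 t x := by
    funext x
    simp [mixedD]
  rw [hzero]
  simp only [sqL2, ← integral_const_mul]
  rw [← integral_add h0 h1]
  exact integral_add (h0.add h1) h2

/-- The energy balance over the truncated strip `[0, t] × [a, b]`. -/
lemma truncated_energy_identity (hu : IsAdmissibleKdVRLW ε β u) {t : ℝ} (ht : 0 < t) (a b : ℝ) :
    (∫ s in (0 : ℝ)..t, ∫ x in a..b, 2 * ε * mixedD u 0 1 s x ^ 2) =
      (∫ s in (0 : ℝ)..t, (energyFlux ε β u s b - energyFlux ε β u s a))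
        - ((∫ x in a..b, energyDensity β u t x) - ∫ x in a..b, energyDensity β u 0 x) := by
  have c0 := continuous_mixedD_zero hu.smooth
  have c1 := continuous_mixedD_one hu.smooth
  have c00 := c0 0
  have c01 := c0 1
  have c02 := c0 2
  have c03 := c0 3
  have c10 := c1 0
  have c11 := c1 1
  have c12 := c1 2
  have c13 := c1 3
  have c14 := c1 4
  have x0 := hasDerivAt_mixedD_zero_space hu.smooth
  have x1 := hasDerivAt_mixedD_one_space hu.smooth
  have t0 := hasDerivAt_mixedD_zero_time hu.smooth
  simp only [Function.uncurry_def] at c00 c01 c02 c03 c10 c11 c12 c13 c14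
  refine integral_balance_law
    (e' := fun s x => 2 * (mixedD u 0 0 s x * mixedD u 1 0 s x)
      + β * (2 * (mixedD u 0 1 s x * mixedD u 1 1 s x))
      + β ^ 2 * (2 * (mixedD u 0 2 s x * mixedD u 1 2 s x)))
    (F' := fun s x => -4 * (mixedD u 0 0 s x ^ 2 * mixedD u 0 1 s x)
      - 2 * β * (mixedD u 0 0 s x * mixedD u 0 3 s x)
      + 2 * β * (mixedD u 0 1 s x * mixedD u 1 1 s x + mixedD u 0 0 s x * mixedD u 1 2 s x)
      - 2 * β ^ 2 * (mixedD u 0 0 s x * mixedD u 1 4 s x - mixedD u 0 2 s x * mixedD u 1 2 s x)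
      + 2 * ε * (mixedD u 0 1 s x ^ 2 + mixedD u 0 0 s x * mixedD u 0 2 s x))
    ?_ ?_ ?_ ?_ ?_ ?_ ?_ ht a b
  · simp only [Function.uncurry_def]
    fun_prop
  · simp only [Function.uncurry_def]
    fun_prop
  · simp only [Function.uncurry_def, energyDensity]
    fun_prop
  · simp only [Function.uncurry_def]
    fun_prop
  · intro s x
    refine ((((t0 0 s x).fun_pow 2).fun_add (((t0 1 s x).fun_pow 2).const_mul β)).fun_add
      (((t0 2 s x).fun_pow 2).const_mul (β ^ 2))).congr_deriv ?_
    norm_num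
    ring
  · intro s x
    refine (((((((x0 0 s x).fun_pow 3).const_mul (-(4 / 3))).fun_sub
      (((((x0 0 s x).fun_mul (x0 2 s x)).const_mul 2).fun_sub
        ((x0 1 s x).fun_pow 2)).const_mul β)).fun_add
      (((x0 0 s x).fun_mul (x1 1 s x)).const_mul (2 * β))).fun_sub
      ((((x0 0 s x).fun_mul (x1 3 s x)).fun_sub
        ((x0 1 s x).fun_mul (x1 2 s x))).const_mul (2 * β ^ 2))).fun_add
      (((x0 0 s x).fun_mul (x0 1 s x)).const_mul (2 * ε))).congr_deriv ?_
    norm_num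
    ring
  · intro s hs x
    have hpde := hu.pde s hs x
    have hsq : deriv (fun y => u s y ^ 2) x = 2 * mixedD u 0 0 s x * mixedD u 0 1 s x := by
      simpa [mixedD] using ((x0 0 s x).fun_pow 2).deriv
    rw [hsq] at hpde
    linear_combination (2 * mixedD u 0 0 s x) * hpde

end IsAdmissibleKdVRLW

/-- Energy identity for the Rosenau–KdV–RLW approximation (★). -/
theorem energy_identity_KdVRLW (ε β : ℝ) (hε : 0 < ε) (hβ : 0 < β)
    (u : ℝ → ℝ → ℝ) (hu : IsAdmissibleKdVRLW ε β u) :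
    ∀ t > (0 : ℝ),
      (sqL2 (u t) + β * sqL2 (fun x => mixedD u 0 1 t x)
          + β ^ 2 * sqL2 (fun x => mixedD u 0 2 t x)
          + 2 * ε * ∫ s in (0 : ℝ)..t, sqL2 (fun x => mixedD u 0 1 s x))
        = sqL2 (u 0) + β * sqL2 (fun x => mixedD u 0 1 0 x)
            + β ^ 2 * sqL2 (fun x => mixedD u 0 2 0 x)
      ∧ ∀ C0 : ℝ,
          sqL2 (u 0) + β * sqL2 (fun x => mixedD u 0 1 0 x)
              + β ^ 2 * sqL2 (fun x => mixedD u 0 2 0 x) ≤ C0 →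
          sqL2 (u t) + β * sqL2 (fun x => mixedD u 0 1 t x)
              + β ^ 2 * sqL2 (fun x => mixedD u 0 2 t x)
              + 2 * ε * (∫ s in (0 : ℝ)..t, sqL2 (fun x => mixedD u 0 1 s x)) ≤ C0 := by
  intro t ht
  have hcast : Tendsto (fun n : ℕ => (n : ℝ)) atTop atTop := tendsto_natCast_atTop_atTop
  have hdens {s : ℝ} (hs : 0 ≤ s) :
      Tendsto (fun n : ℕ => ∫ x in (-(n : ℝ))..n, energyDensity β u s x) atTop
        (nhds (∫ x, energyDensity β u s x)) :=
    intervalIntegral_tendsto_integral (hu.integrable_energyDensity hs)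
      (tendsto_neg_atTop_atBot.comp hcast) hcast
  have hflux : Tendsto (fun n : ℕ => ∫ s in (0 : ℝ)..t,
      (energyFlux ε β u s n - energyFlux ε β u s (-(n : ℝ)))) atTop (nhds 0) := by
    have hslice (x : ℝ) : IntervalIntegrable (fun s => energyFlux ε β u s x) volume 0 t :=
      (hu.continuous_energyFlux.comp
        (by fun_prop : Continuous fun s => (s, x))).intervalIntegrable _ _
    simp only [intervalIntegral.integral_sub (hslice _) (hslice _)]
    simpa using (hu.tendsto_integral_energyFlux hε hβ ht (y := fun n => n) (by simp)).sub
      (hu.tendsto_integral_energyFlux hε hβ ht (y := fun n => -(n : ℝ)) (by simp))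
  have hlim := hflux.sub ((hdens ht.le).sub (hdens le_rfl))
  simp only [← hu.truncated_energy_identity ht] at hlim
  have hcont : Continuous (Function.uncurry fun s x => 2 * ε * mixedD u 0 1 s x ^ 2) :=
    ((continuous_mixedD_zero hu.smooth 1).pow 2).const_mul (2 * ε)
  have hdiss := intervalIntegral_integral_eq_of_tendsto hcont (fun s x => by positivity) ht.le hlim
  simp only [integral_const_mul, intervalIntegral.integral_const_mul,
    hu.integral_energyDensity ht.le, hu.integral_energyDensity le_rfl] at hdiss
  have hmain : (sqL2 (u t) + β * sqL2 (fun x => mixedD u 0 1 t x)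
          + β ^ 2 * sqL2 (fun x => mixedD u 0 2 t x)
          + 2 * ε * ∫ s in (0 : ℝ)..t, sqL2 (fun x => mixedD u 0 1 s x))
        = sqL2 (u 0) + β * sqL2 (fun x => mixedD u 0 1 0 x)
            + β ^ 2 * sqL2 (fun x => mixedD u 0 2 0 x) := by
    simp only [sqL2] at hdiss ⊢
    linarith
  exact ⟨hmain, fun C0 hC0 => hmain.trans_le hC0⟩

end
end

section
/- There exists D > 0 depending only on C₀ (one may take any 0 < D < √2/(4C₀)) such that the following holds: if ε, β > 0 satisfy β ≤ D²ε⁴ and u is an admissible solution of (★) whose initial datum satisfies the data bounds with constant C₀, then there is a constant C depending only on C₀ such that ‖u(t,·)‖_{L⁴(ℝ)} ≤ C for every t > 0. -/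
open MeasureTheory Real Filter Set

noncomputable section

/-- The directional derivative of `g` along the constant vector field `v`. -/
def dirDeriv (v : ℝ × ℝ) (g : ℝ × ℝ → ℝ) : ℝ × ℝ → ℝ := fun p => fderiv ℝ g p v

lemma contDiff_dirDeriv (v : ℝ × ℝ) {g : ℝ × ℝ → ℝ} (hg : ContDiff ℝ (⊤ : ℕ∞) g) :
    ContDiff ℝ (⊤ : ℕ∞) (dirDeriv v g) :=
  (hg.fderiv_right (m := (⊤ : ℕ∞)) (by simp)).clm_apply contDiff_const

lemma contDiff_dirDeriv_iterate (v : ℝ × ℝ) {g : ℝ × ℝ → ℝ} (hg : ContDiff ℝ (⊤ : ℕ∞) g)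
    (k : ℕ) : ContDiff ℝ (⊤ : ℕ∞) ((dirDeriv v)^[k] g) := by
  induction k with
  | zero => exact hg
  | succ k ih =>
    rw [Function.iterate_succ_apply']
    exact contDiff_dirDeriv v ih

lemma dirDeriv_comm (v w : ℝ × ℝ) {g : ℝ × ℝ → ℝ} (hg : ContDiff ℝ (⊤ : ℕ∞) g) :
    dirDeriv v (dirDeriv w g) = dirDeriv w (dirDeriv v g) := by
  have hd : Differentiable ℝ (fderiv ℝ g) :=
    (hg.fderiv_right (m := (⊤ : ℕ∞)) (by simp)).differentiable (by simp)
  have key : ∀ v w p, dirDeriv v (dirDeriv w g) p = fderiv ℝ (fderiv ℝ g) p v w := by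
    intro v w p
    have h := ((hd p).hasFDerivAt.clm_apply (hasFDerivAt_const w p)).fderiv
    unfold dirDeriv
    rw [h]
    simp
  funext p
  rw [key, key]
  exact (hg.contDiffAt (x := p)).isSymmSndFDerivAt
    (by simpa using WithTop.coe_le_coe.2 (le_top : (2 : ℕ∞) ≤ ⊤)) v w

lemma dirDeriv_iterate_comm (v w : ℝ × ℝ) {g : ℝ × ℝ → ℝ} (hg : ContDiff ℝ (⊤ : ℕ∞) g) (j : ℕ) :
    dirDeriv v ((dirDeriv w)^[j] g) = (dirDeriv w)^[j] (dirDeriv v g) := by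
  induction j with
  | zero => rfl
  | succ j ih =>
    rw [Function.iterate_succ_apply', Function.iterate_succ_apply', ← ih,
      dirDeriv_comm v w (contDiff_dirDeriv_iterate w hg j)]

lemma hasDerivAt_snd_dirDeriv {g : ℝ × ℝ → ℝ} (hg : ContDiff ℝ (⊤ : ℕ∞) g) (t x : ℝ) :
    HasDerivAt (fun y => g (t, y)) (dirDeriv (0, 1) g (t, x)) x :=
  ((hg.differentiable (by simp)) (t, x)).hasFDerivAt.comp_hasDerivAt x
    ((hasDerivAt_const x t).prodMk (hasDerivAt_id x))

lemma hasDerivAt_fst_dirDeriv {g : ℝ × ℝ → ℝ} (hg : ContDiff ℝ (⊤ : ℕ∞) g) (t x : ℝ) :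
    HasDerivAt (fun s => g (s, x)) (dirDeriv (1, 0) g (t, x)) t :=
  ((hg.differentiable (by simp)) (t, x)).hasFDerivAt.comp_hasDerivAt t
    ((hasDerivAt_id t).prodMk (hasDerivAt_const t x))

lemma iteratedDeriv_snd_eq_dirDeriv {g : ℝ × ℝ → ℝ} (hg : ContDiff ℝ (⊤ : ℕ∞) g) (k : ℕ)
    (t : ℝ) : iteratedDeriv k (fun y => g (t, y)) = fun x => (dirDeriv (0, 1))^[k] g (t, x) := by
  induction k with
  | zero => simp
  | succ k ih =>
    funext x
    rw [iteratedDeriv_succ, ih, Function.iterate_succ_apply']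
    exact (hasDerivAt_snd_dirDeriv (contDiff_dirDeriv_iterate _ hg k) t x).deriv

lemma iteratedDeriv_fst_eq_dirDeriv {g : ℝ × ℝ → ℝ} (hg : ContDiff ℝ (⊤ : ℕ∞) g) (k : ℕ)
    (x : ℝ) : iteratedDeriv k (fun s => g (s, x)) = fun t => (dirDeriv (1, 0))^[k] g (t, x) := by
  induction k with
  | zero => simp
  | succ k ih =>
    funext t
    rw [iteratedDeriv_succ, ih, Function.iterate_succ_apply']
    exact (hasDerivAt_fst_dirDeriv (contDiff_dirDeriv_iterate _ hg k) t x).deriv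

lemma mixedD_eq_dirDeriv {u : ℝ → ℝ → ℝ}
    (hu : ContDiff ℝ (⊤ : ℕ∞) (fun p : ℝ × ℝ => u p.1 p.2)) (j k : ℕ) (t x : ℝ) :
    mixedD u j k t x =
      (dirDeriv (1, 0))^[j] ((dirDeriv (0, 1))^[k] (fun p : ℝ × ℝ => u p.1 p.2)) (t, x) := by
  unfold mixedD
  have h : (fun s => iteratedDeriv k (fun y => u s y) x) =
      fun s => (dirDeriv (0, 1))^[k] (fun p : ℝ × ℝ => u p.1 p.2) (s, x) := by
    funext s
    exact congrFun (iteratedDeriv_snd_eq_dirDeriv hu k s) x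
  rw [h, iteratedDeriv_fst_eq_dirDeriv (contDiff_dirDeriv_iterate _ hu k)]

lemma continuous_mixedD {u : ℝ → ℝ → ℝ}
    (hu : ContDiff ℝ (⊤ : ℕ∞) (fun p : ℝ × ℝ => u p.1 p.2)) (j k : ℕ) :
    Continuous (fun p : ℝ × ℝ => mixedD u j k p.1 p.2) := by
  simp only [mixedD_eq_dirDeriv hu]
  exact (contDiff_dirDeriv_iterate _ (contDiff_dirDeriv_iterate _ hu k) j).continuous

lemma continuous_mixedD_snd {u : ℝ → ℝ → ℝ}
    (hu : ContDiff ℝ (⊤ : ℕ∞) (fun p : ℝ × ℝ => u p.1 p.2)) (j k : ℕ) (t : ℝ) :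
    Continuous (mixedD u j k t) :=
  (continuous_mixedD hu j k).comp (Continuous.prodMk_right t)

lemma hasDerivAt_mixedD_fst {u : ℝ → ℝ → ℝ}
    (hu : ContDiff ℝ (⊤ : ℕ∞) (fun p : ℝ × ℝ => u p.1 p.2)) (j k : ℕ) (t x : ℝ) :
    HasDerivAt (fun s => mixedD u j k s x) (mixedD u (j + 1) k t x) t := by
  simp only [mixedD_eq_dirDeriv hu]
  rw [Function.iterate_succ_apply']
  exact hasDerivAt_fst_dirDeriv
    (contDiff_dirDeriv_iterate _ (contDiff_dirDeriv_iterate _ hu k) j) t x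

lemma hasDerivAt_mixedD_snd {u : ℝ → ℝ → ℝ}
    (hu : ContDiff ℝ (⊤ : ℕ∞) (fun p : ℝ × ℝ => u p.1 p.2)) (j k : ℕ) (t x : ℝ) :
    HasDerivAt (fun y => mixedD u j k t y) (mixedD u j (k + 1) t x) x := by
  simp only [mixedD_eq_dirDeriv hu]
  rw [Function.iterate_succ_apply', ← dirDeriv_iterate_comm _ _ (contDiff_dirDeriv_iterate _ hu k)]
  exact hasDerivAt_snd_dirDeriv
    (contDiff_dirDeriv_iterate _ (contDiff_dirDeriv_iterate _ hu k) j) t x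

/-- Differentiation under the integral sign over a compact interval for a jointly continuous
derivative. -/
lemma hasDerivAt_intervalIntegral_of_continuous {e e' : ℝ → ℝ → ℝ}
    (he : ∀ t, Continuous (e t)) (he' : Continuous (fun p : ℝ × ℝ => e' p.1 p.2))
    (hde : ∀ t x, HasDerivAt (fun s => e s x) (e' t x) t) (a b t : ℝ) :
    HasDerivAt (fun s => ∫ x in a..b, e s x) (∫ x in a..b, e' t x) t := by
  obtain ⟨M, hM⟩ := ((isCompact_Icc (a := t - 1) (b := t + 1)).prod
    (isCompact_uIcc (a := a) (b := b))).exists_bound_of_continuousOn he'.continuousOn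
  refine (intervalIntegral.hasDerivAt_integral_of_dominated_loc_of_deriv_le
    (s := Icc (t - 1) (t + 1)) (bound := fun _ => M) (F := e) (F' := e')
    (Icc_mem_nhds (by linarith) (by linarith)) ?_ ?_ ?_ ?_ ?_ ?_).2
  · exact Eventually.of_forall fun s => (he s).aestronglyMeasurable
  · exact (he t).intervalIntegrable _ _
  · exact (he'.comp (Continuous.prodMk_right t)).aestronglyMeasurable
  · exact Eventually.of_forall fun x hx s hs => hM (s, x) ⟨hs, uIoc_subset_uIcc hx⟩
  · exact intervalIntegrable_const
  · exact Eventually.of_forall fun x _ s _ => hde s x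

/-- A density `e` whose time derivative is at most the space derivative of a flux vanishing at
infinity has non-increasing total mass. -/
lemma integral_le_integral_of_deriv_le_flux {e e' f f' : ℝ → ℝ → ℝ} {T : ℝ} (hT : 0 < T)
    (he : ∀ t, Continuous (e t)) (he' : Continuous (fun p : ℝ × ℝ => e' p.1 p.2))
    (hf' : ∀ t, Continuous (f' t))
    (hde : ∀ t x, HasDerivAt (fun s => e s x) (e' t x) t)
    (hdf : ∀ t x, HasDerivAt (f t) (f' t x) x)
    (hle : ∀ t > 0, ∀ x, e' t x ≤ f' t x)
    (hlim : Tendsto (fun p : ℝ × ℝ => f p.1 p.2) (𝓟 (Icc 0 T) ×ˢ cocompact ℝ) (nhds 0))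
    (h0 : Integrable (e 0)) (hT' : Integrable (e T)) :
    ∫ x, e T x ≤ ∫ x, e 0 x := by
  refine le_of_forall_pos_le_add fun δ hδ => ?_
  have hev : ∀ᶠ x in cocompact ℝ, ∀ t ∈ Icc 0 T, |f t x| ≤ δ / (2 * T) := by
    have h := hlim.eventually (Metric.closedBall_mem_nhds (0 : ℝ) (by positivity : 0 < δ / (2 * T)))
    rw [prod_comm, eventually_map, eventually_prod_principal_iff] at h
    simpa using h
  rw [cocompact_eq_atBot_atTop, eventually_sup] at hev
  have hR : ∀ᶠ R : ℝ in atTop, ∫ x in (-R)..R, e T x ≤ (∫ x in (-R)..R, e 0 x) + δ := by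
    filter_upwards [tendsto_neg_atTop_atBot.eventually hev.1, hev.2, eventually_ge_atTop 0]
      with R h1 h2 hR0
    have hd := hasDerivAt_intervalIntegral_of_continuous he he' hde (-R) R
    have := (convex_Icc 0 T).image_sub_le_mul_sub_of_deriv_le
      (f := fun t => ∫ x in (-R)..R, e t x) (C := δ / T)
      (fun t _ => (hd t).continuousAt.continuousWithinAt)
      (fun t _ => (hd t).differentiableAt.differentiableWithinAt) ?_
      0 (by simp [hT.le]) T (by simp [hT.le]) hT.le
    · have h3 : δ / T * (T - 0) = δ := by field_simp; ring
      rw [h3] at this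
      linarith
    · intro t ht
      rw [interior_Icc] at ht
      have hflux := intervalIntegral.integral_eq_sub_of_hasDerivAt
        (fun x (_ : x ∈ uIcc (-R) R) => hdf t x) ((hf' t).intervalIntegrable _ _)
      have hmono : ∫ x in (-R)..R, e' t x ≤ ∫ x in (-R)..R, f' t x :=
        intervalIntegral.integral_mono_on (by linarith)
          ((he'.comp (Continuous.prodMk_right t)).intervalIntegrable _ _)
          ((hf' t).intervalIntegrable _ _) fun x _ => hle t ht.1 x
      have h4 := (abs_le.1 (h1 t ⟨ht.1.le, ht.2.le⟩)).1
      have h5 := (abs_le.1 (h2 t ⟨ht.1.le, ht.2.le⟩)).2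
      have h6 : δ / T = δ / (2 * T) + δ / (2 * T) := by field_simp; ring
      rw [(hd t).deriv, h6]
      linarith
  exact le_of_tendsto_of_tendsto
    (intervalIntegral_tendsto_integral hT' tendsto_neg_atTop_atBot tendsto_id)
    ((intervalIntegral_tendsto_integral h0 tendsto_neg_atTop_atBot tendsto_id).add_const δ) hR

/-- The one-dimensional Agmon inequality, with the weight `b` distributing the two factors. -/
lemma sq_le_integral_add_integral_deriv {f f' : ℝ → ℝ} {b : ℝ} (hb : 0 < b)
    (hf : ∀ x, HasDerivAt f (f' x) x) (hf' : Continuous f')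
    (hlim : Tendsto f (cocompact ℝ) (nhds 0))
    (hi : Integrable fun x => f x ^ 2) (hi' : Integrable fun x => f' x ^ 2) (x : ℝ) :
    2 * b * f x ^ 2 ≤ (∫ y, f y ^ 2) + b ^ 2 * ∫ y, f' y ^ 2 := by
  have hfc : Continuous f := continuous_iff_continuousAt.2 fun x => (hf x).continuousAt
  have hsq : ∀ y, HasDerivAt (fun y => f y ^ 2) (2 * f y * f' y) y := fun y => by
    simpa using (hf y).fun_pow 2
  have hlim2 : Tendsto (fun x => f x ^ 2) (cocompact ℝ) (nhds 0) := by simpa using hlim.pow 2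
  rw [cocompact_eq_atBot_atTop, tendsto_sup] at hlim2
  have hint := hi.add (hi'.const_mul (b ^ 2))
  have hfin : ∀ p q : ℝ, p ≤ q → b * |f q ^ 2 - f p ^ 2| ≤
      ∫ y in p..q, (f y ^ 2 + b ^ 2 * f' y ^ 2) := by
    intro p q hpq
    rw [← intervalIntegral.integral_eq_sub_of_hasDerivAt (fun y _ => hsq y)
      (((continuous_const.mul hfc).mul hf').intervalIntegrable _ _)]
    calc _ ≤ b * ∫ y in p..q, |2 * f y * f' y| := by
          gcongr
          exact intervalIntegral.abs_integral_le_integral_abs hpq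
      _ = ∫ y in p..q, b * |2 * f y * f' y| := by rw [intervalIntegral.integral_const_mul]
      _ ≤ _ := by
          refine intervalIntegral.integral_mono_on hpq
            (Continuous.intervalIntegrable (by fun_prop) _ _)
            (Continuous.intervalIntegrable (by fun_prop) _ _) fun y _ => ?_
          rw [← abs_of_pos hb, ← abs_mul, abs_of_pos hb, abs_le]
          constructor <;> nlinarith [sq_nonneg (f y - b * f' y), sq_nonneg (f y + b * f' y)]
  have hR : ∀ᶠ R : ℝ in atTop, 2 * b * f x ^ 2 - b * f R ^ 2 - b * f (-R) ^ 2 ≤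
      ∫ y in (-R)..R, (f y ^ 2 + b ^ 2 * f' y ^ 2) := by
    filter_upwards [eventually_ge_atTop |x|] with R hR
    have h1 := hfin (-R) x (neg_le_of_abs_le hR)
    have h2 := hfin x R (le_of_abs_le hR)
    have hc : Continuous fun y => f y ^ 2 + b ^ 2 * f' y ^ 2 := by fun_prop
    rw [← intervalIntegral.integral_add_adjacent_intervals (hc.intervalIntegrable (-R) x)
      (hc.intervalIntegrable x R)]
    nlinarith [le_abs_self (f x ^ 2 - f (-R) ^ 2), neg_abs_le (f R ^ 2 - f x ^ 2)]
  have hl := ((hlim2.2.const_mul b).const_sub (2 * b * f x ^ 2)).sub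
    ((hlim2.1.comp tendsto_neg_atTop_atBot).const_mul b)
  have := le_of_tendsto_of_tendsto hl
    (intervalIntegral_tendsto_integral hint tendsto_neg_atTop_atBot tendsto_id) hR
  simp only [Pi.add_apply, mul_zero, sub_zero] at this
  rwa [integral_add hi (hi'.const_mul _), integral_const_mul] at this

namespace IsAdmissibleKdVRLW

lemma tendsto_mixedD_s4 {ε β : ℝ} {u : ℝ → ℝ → ℝ}
    (h : IsAdmissibleKdVRLW ε β u) {T : ℝ} (hT : 0 < T) {j k : ℕ} (hjk : j + k ≤ 5) :
    Tendsto (fun p : ℝ × ℝ => mixedD u j k p.1 p.2) (𝓟 (Icc 0 T) ×ˢ cocompact ℝ) (nhds 0) := by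
  rw [Metric.nhds_basis_closedBall.tendsto_right_iff]
  intro δ hδ
  obtain ⟨M, hM⟩ := h.decay T hT j k hjk δ hδ
  rw [prod_comm, eventually_map, eventually_prod_principal_iff]
  have : ∀ᶠ x : ℝ in cocompact ℝ, M ≤ ‖x‖ := tendsto_norm_cocompact_atTop.eventually_ge_atTop M
  filter_upwards [this] with x hx t ht
  simpa using hM x hx t ht

lemma tendsto_cocompact {ε β : ℝ} {u : ℝ → ℝ → ℝ}
    (h : IsAdmissibleKdVRLW ε β u) {t : ℝ} (ht : 0 ≤ t) :
    Tendsto (mixedD u 0 0 t) (cocompact ℝ) (nhds 0) := by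
  have hl := h.tendsto_mixedD_s4 (T := t + 1) (by linarith) (j := 0) (k := 0) (by norm_num)
  have hm : t ∈ Icc 0 (t + 1) := ⟨ht, by linarith⟩
  have hp : Tendsto (fun x : ℝ => (t, x)) (cocompact ℝ) (𝓟 (Icc 0 (t + 1)) ×ˢ cocompact ℝ) :=
    (tendsto_principal.2 (Eventually.of_forall fun _ => hm)).prodMk tendsto_id
  exact hl.comp hp

lemma integrable_sq {ε β : ℝ} {u : ℝ → ℝ → ℝ}
    (h : IsAdmissibleKdVRLW ε β u) {t : ℝ} (ht : 0 ≤ t) {j k : ℕ} (hjk : j + k ≤ 5) :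
    Integrable fun x => mixedD u j k t x ^ 2 :=
  h.sq_int (t + 1) (by linarith) j k hjk t ⟨ht, by linarith⟩

lemma pde_mixedD {ε β : ℝ} {u : ℝ → ℝ → ℝ}
    (h : IsAdmissibleKdVRLW ε β u) {t : ℝ} (ht : 0 < t) (x : ℝ) :
    mixedD u 1 0 t x + 2 * mixedD u 0 0 t x * mixedD u 0 1 t x + β * mixedD u 0 3 t x
      - β * mixedD u 1 2 t x + β ^ 2 * mixedD u 1 4 t x - ε * mixedD u 0 2 t x = 0 := by
  have hd : deriv (fun y => u t y ^ 2) x = 2 * mixedD u 0 0 t x * mixedD u 0 1 t x := by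
    have := ((hasDerivAt_mixedD_snd h.smooth 0 0 t x).fun_pow 2).deriv
    simpa [mixedD] using this
  have := h.pde t ht x
  rw [hd] at this
  linarith

/-- Dissipation of the `H²`-type energy obtained by testing the equation against `u`. -/
lemma energy_le {ε β : ℝ} {u : ℝ → ℝ → ℝ}
    (h : IsAdmissibleKdVRLW ε β u) (hε : 0 ≤ ε) {T : ℝ} (hT : 0 < T) :
    (∫ x, mixedD u 0 0 T x ^ 2) + β * (∫ x, mixedD u 0 1 T x ^ 2)
        + β ^ 2 * (∫ x, mixedD u 0 2 T x ^ 2) ≤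
      (∫ x, mixedD u 0 0 0 x ^ 2) + β * (∫ x, mixedD u 0 1 0 x ^ 2)
        + β ^ 2 * (∫ x, mixedD u 0 2 0 x ^ 2) := by
  have hc := continuous_mixedD h.smooth
  have hcx := continuous_mixedD_snd h.smooth
  have ht := hasDerivAt_mixedD_fst h.smooth
  have hx := hasDerivAt_mixedD_snd h.smooth
  have hl : ∀ {j k : ℕ}, j + k ≤ 5 → _ := fun hjk => h.tendsto_mixedD_s4 hT hjk
  have hi : ∀ t, 0 ≤ t → Integrable fun x =>
      mixedD u 0 0 t x ^ 2 + β * mixedD u 0 1 t x ^ 2 + β ^ 2 * mixedD u 0 2 t x ^ 2 :=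
    fun t ht0 => ((h.integrable_sq ht0 (by norm_num)).add
      ((h.integrable_sq ht0 (by norm_num)).const_mul _)).add
      ((h.integrable_sq ht0 (by norm_num)).const_mul _)
  have hsplit : ∀ t, 0 ≤ t → ∫ x,
      (mixedD u 0 0 t x ^ 2 + β * mixedD u 0 1 t x ^ 2 + β ^ 2 * mixedD u 0 2 t x ^ 2) =
      (∫ x, mixedD u 0 0 t x ^ 2) + β * (∫ x, mixedD u 0 1 t x ^ 2)
        + β ^ 2 * (∫ x, mixedD u 0 2 t x ^ 2) := fun t ht0 => by
    have i0 := h.integrable_sq ht0 (j := 0) (k := 0) (by norm_num)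
    have i1 := (h.integrable_sq ht0 (j := 0) (k := 1) (by norm_num)).const_mul β
    have i2 := (h.integrable_sq ht0 (j := 0) (k := 2) (by norm_num)).const_mul (β ^ 2)
    rw [integral_add (by exact i0.add i1) i2, integral_add i0 i1, integral_const_mul,
      integral_const_mul]
  rw [← hsplit T hT.le, ← hsplit 0 le_rfl]
  refine integral_le_integral_of_deriv_le_flux
    (e := fun t x =>
      mixedD u 0 0 t x ^ 2 + β * mixedD u 0 1 t x ^ 2 + β ^ 2 * mixedD u 0 2 t x ^ 2)
    (e' := fun t x => 2 * mixedD u 0 0 t x * mixedD u 1 0 t x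
      + β * (2 * mixedD u 0 1 t x * mixedD u 1 1 t x)
      + β ^ 2 * (2 * mixedD u 0 2 t x * mixedD u 1 2 t x))
    (f := fun t x => 2 * (-(2 / 3) * mixedD u 0 0 t x ^ 3
      - β * (mixedD u 0 0 t x * mixedD u 0 2 t x - 1 / 2 * mixedD u 0 1 t x ^ 2)
      + β * (mixedD u 0 0 t x * mixedD u 1 1 t x)
      - β ^ 2 * (mixedD u 0 0 t x * mixedD u 1 3 t x - mixedD u 0 1 t x * mixedD u 1 2 t x)
      + ε * (mixedD u 0 0 t x * mixedD u 0 1 t x)))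
    (f' := fun t x => 2 * (-2 * mixedD u 0 0 t x ^ 2 * mixedD u 0 1 t x
      - β * (mixedD u 0 0 t x * mixedD u 0 3 t x)
      + β * (mixedD u 0 1 t x * mixedD u 1 1 t x + mixedD u 0 0 t x * mixedD u 1 2 t x)
      - β ^ 2 * (mixedD u 0 0 t x * mixedD u 1 4 t x - mixedD u 0 2 t x * mixedD u 1 2 t x)
      + ε * (mixedD u 0 1 t x ^ 2 + mixedD u 0 0 t x * mixedD u 0 2 t x)))
    hT ?_ ?_ ?_ ?_ ?_ ?_ ?_ (hi 0 le_rfl) (hi T hT.le)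
  · fun_prop
  · fun_prop
  · fun_prop
  · intro t x
    refine ((((ht 0 0 t x).fun_pow 2).fun_add (((ht 0 1 t x).fun_pow 2).const_mul β)).fun_add
      (((ht 0 2 t x).fun_pow 2).const_mul (β ^ 2))).congr_deriv ?_
    simp
  · intro t x
    refine (((((((hx 0 0 t x).fun_pow 3).const_mul (-(2 / 3))).fun_sub
      ((((hx 0 0 t x).fun_mul (hx 0 2 t x)).fun_sub
        (((hx 0 1 t x).fun_pow 2).const_mul (1 / 2))).const_mul β)).fun_add
      (((hx 0 0 t x).fun_mul (hx 1 1 t x)).const_mul β)).fun_sub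
      ((((hx 0 0 t x).fun_mul (hx 1 3 t x)).fun_sub
        ((hx 0 1 t x).fun_mul (hx 1 2 t x))).const_mul (β ^ 2))).fun_add
      (((hx 0 0 t x).fun_mul (hx 0 1 t x)).const_mul ε)).const_mul 2 |>.congr_deriv ?_
    push_cast
    ring
  · intro t ht0 x
    have hp := h.pde_mixedD ht0 x
    have hd : 0 ≤ ε * mixedD u 0 1 t x ^ 2 := by positivity
    linear_combination 2 * hd + 2 * mixedD u 0 0 t x * hp
  · have l00 := hl (j := 0) (k := 0) (by norm_num)
    have l01 := hl (j := 0) (k := 1) (by norm_num)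
    have l02 := hl (j := 0) (k := 2) (by norm_num)
    have l11 := hl (j := 1) (k := 1) (by norm_num)
    have l12 := hl (j := 1) (k := 2) (by norm_num)
    have l13 := hl (j := 1) (k := 3) (by norm_num)
    exact ((((((l00.pow 3).const_mul (-(2 / 3))).sub
      (((l00.mul l02).sub ((l01.pow 2).const_mul (1 / 2))).const_mul β)).add
      ((l00.mul l11).const_mul β)).sub
      (((l00.mul l13).sub (l01.mul l12)).const_mul (β ^ 2))).add
      ((l00.mul l01).const_mul ε)).const_mul 2 |>.mono_right (le_of_eq (by norm_num))

/-- Uniform bound on the solution in terms of the conserved energy. -/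
lemma sq_le_energy {ε β : ℝ} {u : ℝ → ℝ → ℝ}
    (h : IsAdmissibleKdVRLW ε β u) {b : ℝ} (hb : 0 < b) (hβ : β = b ^ 2) (hε : 0 ≤ ε)
    {t : ℝ} (ht : 0 ≤ t) (x : ℝ) :
    2 * b * mixedD u 0 0 t x ^ 2 ≤
      (∫ x, mixedD u 0 0 0 x ^ 2) + β * (∫ x, mixedD u 0 1 0 x ^ 2)
        + β ^ 2 * (∫ x, mixedD u 0 2 0 x ^ 2) := by
  have hE : (∫ x, mixedD u 0 0 t x ^ 2) + β * (∫ x, mixedD u 0 1 t x ^ 2)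
        + β ^ 2 * (∫ x, mixedD u 0 2 t x ^ 2) ≤
      (∫ x, mixedD u 0 0 0 x ^ 2) + β * (∫ x, mixedD u 0 1 0 x ^ 2)
        + β ^ 2 * (∫ x, mixedD u 0 2 0 x ^ 2) := by
    rcases ht.eq_or_lt with rfl | ht
    · exact le_rfl
    · exact h.energy_le hε ht
  have hA := sq_le_integral_add_integral_deriv (f := mixedD u 0 0 t)
    (f' := mixedD u 0 1 t) hb (hasDerivAt_mixedD_snd h.smooth 0 0 t)
    (continuous_mixedD_snd h.smooth 0 1 t)
    (h.tendsto_cocompact ht) (h.integrable_sq ht (by norm_num))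
    (h.integrable_sq ht (by norm_num)) x
  have h2 : 0 ≤ β ^ 2 * ∫ x, mixedD u 0 2 t x ^ 2 :=
    mul_nonneg (sq_nonneg _) (integral_nonneg fun _ => sq_nonneg _)
  rw [← hβ] at hA
  linarith

lemma integrable_pow_four_of_sq_le {ε β : ℝ} {u : ℝ → ℝ → ℝ}
    (h : IsAdmissibleKdVRLW ε β u) {M t : ℝ} (ht : 0 ≤ t) (hM : ∀ x, mixedD u 0 0 t x ^ 2 ≤ M) :
    Integrable fun x => mixedD u 0 0 t x ^ 4 := by
  have hc := continuous_mixedD_snd h.smooth 0 0 t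
  refine ((h.integrable_sq ht (j := 0) (k := 0) (by norm_num)).const_mul M).mono'
    (hc.pow 4).aestronglyMeasurable (Eventually.of_forall fun x => ?_)
  rw [Real.norm_of_nonneg (by positivity)]
  nlinarith [hM x, sq_nonneg (mixedD u 0 0 t x)]

end IsAdmissibleKdVRLW

/-- Positivity of the quadratic form dissipated by the `L⁴` energy. -/
lemma dissipation_form_nonneg {k η a p q r s : ℝ} (hk : k ^ 2 ≤ 9 / 25) (hη : η ^ 2 ≤ 1 / 400) :
    0 ≤ 3 * a ^ 2 - 3 * k * a * p + 3 * k * a * q - 3 * k * a * s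
      + 3 / 2 * (q ^ 2 - 2 * a * r + p * s + r ^ 2 + s ^ 2) + 2 * (p ^ 2 - 2 * η * a * p) := by
  have hc : (3 / 2 * k + 4 * η) ^ 2 ≤ 17 / 10 := by
    nlinarith [sq_nonneg (3 / 2 * k - 4 * η)]
  have hsum : 0 ≤ 3 / 2 * (r - a) ^ 2 + 3 / 2 * (q + k * a) ^ 2 + 3 / 2 * (s + p / 2 - k * a) ^ 2
      + 21 / 50 * (a - (3 / 2 * k + 4 * η) * p * (25 / 21)) ^ 2 := by positivity
  have h1 : 0 ≤ (27 / 25 - 3 * k ^ 2) * a ^ 2 := mul_nonneg (by linarith) (sq_nonneg a)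
  have h2 : 0 ≤ (13 / 8 - (3 / 2 * k + 4 * η) ^ 2 * (25 / 42)) * p ^ 2 :=
    mul_nonneg (by linarith) (sq_nonneg p)
  linear_combination hsum + h1 + h2

/-- Dissipation of the quartic energy obtained by testing the equation against
`u³ - (3/2) ε β ∂ₜ∂ₓ²u - 2 β ∂ₓ²u`, under a smallness condition on the dispersion. -/
lemma IsAdmissibleKdVRLW.quartic_energy_le {ε β : ℝ} {u : ℝ → ℝ → ℝ}
    (h : IsAdmissibleKdVRLW ε β u) {b : ℝ} (hε : 0 < ε) (hb : 0 < b) (hβ : β = b ^ 2)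
    (hbε : b ^ 2 ≤ ε ^ 2 / 400)
    (hM : ∀ t, 0 ≤ t → ∀ x, b ^ 2 * mixedD u 0 0 t x ^ 2 ≤ 9 / 25 * ε ^ 2)
    {T : ℝ} (hT : 0 < T) :
    (∫ x, mixedD u 0 0 T x ^ 4) + 4 * β * (∫ x, mixedD u 0 1 T x ^ 2)
        + (4 * β ^ 2 + 3 * ε ^ 2 * β) * (∫ x, mixedD u 0 2 T x ^ 2)
        + 4 * β ^ 3 * (∫ x, mixedD u 0 3 T x ^ 2) ≤
      (∫ x, mixedD u 0 0 0 x ^ 4) + 4 * β * (∫ x, mixedD u 0 1 0 x ^ 2)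
        + (4 * β ^ 2 + 3 * ε ^ 2 * β) * (∫ x, mixedD u 0 2 0 x ^ 2)
        + 4 * β ^ 3 * (∫ x, mixedD u 0 3 0 x ^ 2) := by
  have hc := continuous_mixedD h.smooth
  have hcx := continuous_mixedD_snd h.smooth
  have ht := hasDerivAt_mixedD_fst h.smooth
  have hx := hasDerivAt_mixedD_snd h.smooth
  have i4 : ∀ t, 0 ≤ t → Integrable fun x => mixedD u 0 0 t x ^ 4 := fun t ht0 =>
    h.integrable_pow_four_of_sq_le (M := 9 / 25 * ε ^ 2 / b ^ 2) ht0 fun x => by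
      rw [le_div_iff₀ (by positivity)]
      linarith [hM t ht0 x]
  have i1 : ∀ t, 0 ≤ t → Integrable fun x => 4 * β * mixedD u 0 1 t x ^ 2 := fun t ht0 =>
    (h.integrable_sq ht0 (by norm_num)).const_mul _
  have i2 : ∀ t, 0 ≤ t → Integrable fun x =>
      (4 * β ^ 2 + 3 * ε ^ 2 * β) * mixedD u 0 2 t x ^ 2 := fun t ht0 =>
    (h.integrable_sq ht0 (by norm_num)).const_mul _
  have i3 : ∀ t, 0 ≤ t → Integrable fun x => 4 * β ^ 3 * mixedD u 0 3 t x ^ 2 := fun t ht0 =>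
    (h.integrable_sq ht0 (by norm_num)).const_mul _
  have hi : ∀ t, 0 ≤ t → Integrable fun x => mixedD u 0 0 t x ^ 4
      + 4 * β * mixedD u 0 1 t x ^ 2 + (4 * β ^ 2 + 3 * ε ^ 2 * β) * mixedD u 0 2 t x ^ 2
      + 4 * β ^ 3 * mixedD u 0 3 t x ^ 2 := fun t ht0 =>
    (((i4 t ht0).add (i1 t ht0)).add (i2 t ht0)).add (i3 t ht0)
  have hsplit : ∀ t, 0 ≤ t → ∫ x, (mixedD u 0 0 t x ^ 4
      + 4 * β * mixedD u 0 1 t x ^ 2 + (4 * β ^ 2 + 3 * ε ^ 2 * β) * mixedD u 0 2 t x ^ 2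
      + 4 * β ^ 3 * mixedD u 0 3 t x ^ 2) =
      (∫ x, mixedD u 0 0 t x ^ 4) + 4 * β * (∫ x, mixedD u 0 1 t x ^ 2)
        + (4 * β ^ 2 + 3 * ε ^ 2 * β) * (∫ x, mixedD u 0 2 t x ^ 2)
        + 4 * β ^ 3 * (∫ x, mixedD u 0 3 t x ^ 2) := fun t ht0 => by
    rw [integral_add (by exact ((i4 t ht0).add (i1 t ht0)).add (i2 t ht0)) (i3 t ht0),
      integral_add (by exact (i4 t ht0).add (i1 t ht0)) (i2 t ht0),
      integral_add (i4 t ht0) (i1 t ht0), integral_const_mul, integral_const_mul,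
      integral_const_mul]
  rw [← hsplit T hT.le, ← hsplit 0 le_rfl]
  refine integral_le_integral_of_deriv_le_flux
    (e := fun t x => mixedD u 0 0 t x ^ 4
      + 4 * β * mixedD u 0 1 t x ^ 2 + (4 * β ^ 2 + 3 * ε ^ 2 * β) * mixedD u 0 2 t x ^ 2
      + 4 * β ^ 3 * mixedD u 0 3 t x ^ 2)
    (e' := fun t x => 4 * mixedD u 0 0 t x ^ 3 * mixedD u 1 0 t x
      + 4 * β * (2 * mixedD u 0 1 t x * mixedD u 1 1 t x)
      + (4 * β ^ 2 + 3 * ε ^ 2 * β) * (2 * mixedD u 0 2 t x * mixedD u 1 2 t x)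
      + 4 * β ^ 3 * (2 * mixedD u 0 3 t x * mixedD u 1 3 t x))
    (f := fun t x => 4 * (-(2 / 5) * mixedD u 0 0 t x ^ 5
      + mixedD u 0 0 t x ^ 3 * (β * mixedD u 1 1 t x - β * mixedD u 0 2 t x
        - β ^ 2 * mixedD u 1 3 t x + ε * mixedD u 0 1 t x)
      + 3 / 2 * ε * β * (mixedD u 1 1 t x * mixedD u 1 0 t x
        + β * (mixedD u 0 2 t x * mixedD u 1 2 t x)
        + β ^ 2 * (mixedD u 1 3 t x * mixedD u 1 2 t x))
      + 2 * β * (mixedD u 0 1 t x * mixedD u 1 0 t x + β / 2 * mixedD u 0 2 t x ^ 2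
        + β ^ 2 * (mixedD u 1 3 t x * mixedD u 0 2 t x))))
    (f' := fun t x => 4 * (-2 * mixedD u 0 0 t x ^ 4 * mixedD u 0 1 t x
      + (3 * mixedD u 0 0 t x ^ 2 * mixedD u 0 1 t x * (β * mixedD u 1 1 t x
          - β * mixedD u 0 2 t x - β ^ 2 * mixedD u 1 3 t x + ε * mixedD u 0 1 t x)
        + mixedD u 0 0 t x ^ 3 * (β * mixedD u 1 2 t x - β * mixedD u 0 3 t x
          - β ^ 2 * mixedD u 1 4 t x + ε * mixedD u 0 2 t x))
      + 3 / 2 * ε * β * (mixedD u 1 2 t x * mixedD u 1 0 t x + mixedD u 1 1 t x ^ 2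
        + β * (mixedD u 0 3 t x * mixedD u 1 2 t x + mixedD u 0 2 t x * mixedD u 1 3 t x)
        + β ^ 2 * (mixedD u 1 4 t x * mixedD u 1 2 t x + mixedD u 1 3 t x ^ 2))
      + 2 * β * (mixedD u 0 2 t x * mixedD u 1 0 t x + mixedD u 0 1 t x * mixedD u 1 1 t x
        + β * (mixedD u 0 2 t x * mixedD u 0 3 t x)
        + β ^ 2 * (mixedD u 1 4 t x * mixedD u 0 2 t x + mixedD u 1 3 t x * mixedD u 0 3 t x))))
    hT ?_ ?_ ?_ ?_ ?_ ?_ ?_ (hi 0 le_rfl) (hi T hT.le)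
  · fun_prop
  · fun_prop
  · fun_prop
  · intro t x
    refine (((((ht 0 0 t x).fun_pow 4).fun_add
      (((ht 0 1 t x).fun_pow 2).const_mul (4 * β))).fun_add
      (((ht 0 2 t x).fun_pow 2).const_mul (4 * β ^ 2 + 3 * ε ^ 2 * β))).fun_add
      (((ht 0 3 t x).fun_pow 2).const_mul (4 * β ^ 3))).congr_deriv ?_
    simp
  · intro t x
    refine (((((hx 0 0 t x).fun_pow 5).const_mul (-(2 / 5))).fun_add
      (((hx 0 0 t x).fun_pow 3).fun_mul (((((hx 1 1 t x).const_mul β).fun_sub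
        ((hx 0 2 t x).const_mul β)).fun_sub ((hx 1 3 t x).const_mul (β ^ 2))).fun_add
        ((hx 0 1 t x).const_mul ε)))).fun_add
      (((((hx 1 1 t x).fun_mul (hx 1 0 t x)).fun_add
        (((hx 0 2 t x).fun_mul (hx 1 2 t x)).const_mul β)).fun_add
        (((hx 1 3 t x).fun_mul (hx 1 2 t x)).const_mul (β ^ 2))).const_mul
          (3 / 2 * ε * β))).fun_add
      (((((hx 0 1 t x).fun_mul (hx 1 0 t x)).fun_add
        (((hx 0 2 t x).fun_pow 2).const_mul (β / 2))).fun_add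
        (((hx 1 3 t x).fun_mul (hx 0 2 t x)).const_mul (β ^ 2))).const_mul
          (2 * β)) |>.const_mul 4 |>.congr_deriv ?_
    push_cast
    ring
  · intro t ht0 x
    have hp := h.pde_mixedD ht0 x
    have hk : (b * mixedD u 0 0 t x / ε) ^ 2 ≤ 9 / 25 := by
      rw [div_pow, div_le_iff₀ (by positivity), mul_pow]
      exact hM t ht0.le x
    have hη : (b / ε) ^ 2 ≤ 1 / 400 := by
      rw [div_pow, div_le_iff₀ (by positivity)]
      linarith
    have hd := mul_nonneg hε.le (dissipation_form_nonneg
      (a := mixedD u 0 0 t x * mixedD u 0 1 t x) (p := b * mixedD u 0 2 t x)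
      (q := b * mixedD u 1 1 t x) (r := b ^ 2 * mixedD u 1 2 t x)
      (s := b ^ 3 * mixedD u 1 3 t x) hk hη)
    have hk' : ε * (b * mixedD u 0 0 t x / ε) = b * mixedD u 0 0 t x := by field_simp
    have hη' : ε * (b / ε) = b := by field_simp
    generalize b * mixedD u 0 0 t x / ε = k at *
    generalize b / ε = η at *
    subst hβ
    linear_combination 4 * hd
      + 4 * (mixedD u 0 0 t x ^ 3 - 3 / 2 * ε * b ^ 2 * mixedD u 1 2 t x
        - 2 * b ^ 2 * mixedD u 0 2 t x) * hp
      + 12 * mixedD u 0 0 t x * mixedD u 0 1 t x * (b * mixedD u 1 1 t x - b * mixedD u 0 2 t x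
        - b ^ 3 * mixedD u 1 3 t x) * hk'
      - 16 * (mixedD u 0 0 t x * mixedD u 0 1 t x) * (b * mixedD u 0 2 t x) * hη'
  · have hl : ∀ j k : ℕ, j + k ≤ 5 → _ := fun j k hjk => h.tendsto_mixedD_s4 hT hjk
    have l00 := hl 0 0 (by norm_num)
    have l01 := hl 0 1 (by norm_num)
    have l02 := hl 0 2 (by norm_num)
    have l10 := hl 1 0 (by norm_num)
    have l11 := hl 1 1 (by norm_num)
    have l12 := hl 1 2 (by norm_num)
    have l13 := hl 1 3 (by norm_num)
    exact ((((l00.pow 5).const_mul (-(2 / 5))).add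
      ((l00.pow 3).mul ((((l11.const_mul β).sub (l02.const_mul β)).sub
        (l13.const_mul (β ^ 2))).add (l01.const_mul ε)))).add
      ((((l11.mul l10).add ((l02.mul l12).const_mul β)).add
        ((l13.mul l12).const_mul (β ^ 2))).const_mul (3 / 2 * ε * β))).add
      ((((l01.mul l10).add ((l02.pow 2).const_mul (β / 2))).add
        ((l13.mul l02).const_mul (β ^ 2))).const_mul (2 * β))
      |>.const_mul 4 |>.mono_right (le_of_eq (by norm_num))

/-- The quartic mass of an admissible solution is controlled by the data constant alone. -/
lemma IsAdmissibleKdVRLW.integral_pow_four_le {ε β C0 D : ℝ} {u : ℝ → ℝ → ℝ}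
    (h : IsAdmissibleKdVRLW ε β u) (hC0 : 0 < C0) (hD : 0 < D) (hDC : D < √2 / (4 * C0))
    (hε : 0 < ε) (hβ0 : 0 < β) (hβD : β ≤ D ^ 2 * ε ^ 4) (hdata : DataBoundsKdVRLW ε β C0 (u 0))
    {t : ℝ} (ht : 0 < t) : ∫ x, u t x ^ 4 ≤ 300 * C0 := by
  obtain ⟨b, hb, rfl⟩ : ∃ b, 0 < b ∧ β = b ^ 2 :=
    ⟨√β, Real.sqrt_pos.2 hβ0, (Real.sq_sqrt hβ0.le).symm⟩
  have hbD : b ≤ D * ε ^ 2 :=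
    le_of_sq_le_sq (by linarith : b ^ 2 ≤ (D * ε ^ 2) ^ 2) (by positivity)
  have hDC' : D * C0 ≤ 9 / 25 := by
    rw [lt_div_iff₀ (by positivity)] at hDC
    have : √2 ≤ 36 / 25 := Real.sqrt_le_iff.2 (by norm_num)
    linarith
  have hm : ∀ k s, mixedD u 0 k s = iteratedDeriv k (u s) := fun k s => by
    funext x
    simp [mixedD]
  obtain ⟨hd1, hd2, -⟩ := hdata
  have hu0 : ∀ s, u s = mixedD u 0 0 s := fun s => by rw [hm, iteratedDeriv_zero]
  rw [← iteratedDeriv_one, ← hm, hu0 0] at hd1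
  rw [← hm, ← hm] at hd2
  rw [hu0 t]
  have hn : ∀ k, 0 ≤ ∫ x, mixedD u 0 k 0 x ^ 2 := fun k => integral_nonneg fun _ => sq_nonneg _
  have hnt : ∀ k, 0 ≤ ∫ x, mixedD u 0 k t x ^ 2 := fun k => integral_nonneg fun _ => sq_nonneg _
  have hn4 : 0 ≤ ∫ x, mixedD u 0 0 0 x ^ 4 := integral_nonneg fun _ => by positivity
  have hE0 : (∫ x, mixedD u 0 0 0 x ^ 2) + b ^ 2 * (∫ x, mixedD u 0 1 0 x ^ 2)
      + (b ^ 2) ^ 2 * (∫ x, mixedD u 0 2 0 x ^ 2) ≤ 2 * C0 := by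
    have p1 : 0 ≤ ε ^ 2 * ∫ x, mixedD u 0 1 0 x ^ 2 := mul_nonneg (by positivity) (hn 1)
    have p2 : 0 ≤ (b ^ 2 * ε + b ^ 2 * ε ^ 2) * ∫ x, mixedD u 0 2 0 x ^ 2 :=
      mul_nonneg (by positivity) (hn 2)
    have p3 : 0 ≤ ((b ^ 2) ^ 2 * ε ^ 2 + (b ^ 2) ^ 3) * ∫ x, mixedD u 0 3 0 x ^ 2 :=
      mul_nonneg (by positivity) (hn 3)
    linarith
  have hsup : ∀ s, 0 ≤ s → ∀ x, b * mixedD u 0 0 s x ^ 2 ≤ C0 := fun s hs x => by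
    linarith [h.sq_le_energy hb rfl hε.le hs x]
  rcases le_or_gt (b * D) (1 / 400) with hsmall | hlarge
  · have hbε : b ^ 2 ≤ ε ^ 2 / 400 := by
      nlinarith [mul_le_mul_of_nonneg_left hbD hb.le,
        mul_le_mul_of_nonneg_right hsmall (sq_nonneg ε)]
    have hM : ∀ s, 0 ≤ s → ∀ x, b ^ 2 * mixedD u 0 0 s x ^ 2 ≤ 9 / 25 * ε ^ 2 := fun s hs x => by
      nlinarith [mul_le_mul_of_nonneg_left (hsup s hs x) hb.le,
        mul_le_mul_of_nonneg_right hbD hC0.le,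
        mul_le_mul_of_nonneg_right hDC' (sq_nonneg ε)]
    have hQ := h.quartic_energy_le hε hb rfl hbε hM ht
    have q1 : 0 ≤ 4 * b ^ 2 * ∫ x, mixedD u 0 1 t x ^ 2 := mul_nonneg (by positivity) (hnt 1)
    have q2 : 0 ≤ (4 * (b ^ 2) ^ 2 + 3 * ε ^ 2 * b ^ 2) * ∫ x, mixedD u 0 2 t x ^ 2 :=
      mul_nonneg (by positivity) (hnt 2)
    have q3 : 0 ≤ 4 * (b ^ 2) ^ 3 * ∫ x, mixedD u 0 3 t x ^ 2 :=
      mul_nonneg (by positivity) (hnt 3)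
    have p1 : 0 ≤ ε ^ 2 * ∫ x, mixedD u 0 1 0 x ^ 2 := mul_nonneg (by positivity) (hn 1)
    have p2 : 0 ≤ (4 * b ^ 2 * ε + b ^ 2 * ε ^ 2) * ∫ x, mixedD u 0 2 0 x ^ 2 :=
      mul_nonneg (by positivity) (hn 2)
    have p3 : 0 ≤ (b ^ 2) ^ 2 * ε ^ 2 * ∫ x, mixedD u 0 3 0 x ^ 2 :=
      mul_nonneg (by positivity) (hn 3)
    linarith [hn 0]
  · have hM : ∀ x, mixedD u 0 0 t x ^ 2 ≤ C0 / b := fun x => by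
      rw [le_div_iff₀ hb]
      linarith [hsup t ht.le x]
    have hE := h.energy_le hε.le ht
    have p1 : 0 ≤ b ^ 2 * ∫ x, mixedD u 0 1 t x ^ 2 := mul_nonneg (by positivity) (hnt 1)
    have p2 : 0 ≤ (b ^ 2) ^ 2 * ∫ x, mixedD u 0 2 t x ^ 2 := mul_nonneg (by positivity) (hnt 2)
    have hb' : C0 / b ≤ 144 := by
      rw [div_le_iff₀ hb]
      nlinarith
    calc ∫ x, mixedD u 0 0 t x ^ 4 ≤ ∫ x, C0 / b * mixedD u 0 0 t x ^ 2 := by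
          refine integral_mono (h.integrable_pow_four_of_sq_le ht.le hM)
            ((h.integrable_sq ht.le (by norm_num)).const_mul _) fun x => ?_
          beta_reduce
          nlinarith [hM x, sq_nonneg (mixedD u 0 0 t x)]
      _ = C0 / b * ∫ x, mixedD u 0 0 t x ^ 2 := integral_const_mul _ _
      _ ≤ 144 * (2 * C0) := by
          gcongr
          linarith
      _ ≤ 300 * C0 := by linarith

/-- Uniform `L⁴` bound for the Rosenau–KdV–RLW approximation (★): any
`0 < D < √2/(4C₀)` works. -/
theorem L4_bound_KdVRLW (C0 : ℝ) (hC0 : 0 < C0) :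
    ∀ D : ℝ, 0 < D → D < Real.sqrt 2 / (4 * C0) →
      ∃ C : ℝ, 0 < C ∧
        ∀ ε β : ℝ, 0 < ε → 0 < β → β ≤ D ^ 2 * ε ^ 4 →
          ∀ u : ℝ → ℝ → ℝ, IsAdmissibleKdVRLW ε β u →
            DataBoundsKdVRLW ε β C0 (u 0) →
            ∀ t > (0 : ℝ), nL4 (u t) ≤ C := by
  intro D hD hDC
  refine ⟨(300 * C0) ^ ((1 : ℝ) / 4), by positivity, ?_⟩
  intro ε β hε hβ hβD u h hdata t ht
  exact Real.rpow_le_rpow (integral_nonneg fun x => by positivity)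
    (h.integral_pow_four_le hC0 hD hDC hε hβ hβD hdata ht) (by norm_num)

end
end
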